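/- For every integer l ≥ 1 and real x ≥ 0, the l-th moment integral of the continuous binomial coefficients satisfies ∫_0^x s^l·{x brace s} ds = ∑_{n=0}^∞ [ 2·(n+l)_l · x^{2n+l+1} + (n+l)_{l−1} · x^{2n+l+2} ] / (2n+l+1)!, where (a)_m = a(a−1)⋯(a−m+1) denotes the falling factorial. -/

import Mathlib

/-- The continuous binomial coefficient `{x brace s}`. -/
noncomputable def contBinom (x s : ℝ) : ℝ :=
  ∑' n : ℕ, (x + 2 * n + 2) * s ^ n * (x - s) ^ n /
    ((Nat.factorial n : ℝ) * (Nat.factorial (n + 1) : ℝ))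

lemma beta_aux (x : ℝ) (b : ℕ) : ∀ a : ℕ,
    (∫ s in (0 : ℝ)..x, s ^ a * (x - s) ^ b) =
      (Nat.factorial a : ℝ) * (Nat.factorial b : ℝ) / (Nat.factorial (a + b + 1) : ℝ)
        * x ^ (a + b + 1) := by
  induction b with
  | zero =>
    intro a
    simp only [pow_zero, mul_one, integral_pow, add_zero, Nat.factorial_succ, Nat.factorial_zero]
    have := Nat.factorial_ne_zero a
    push_cast
    field_simp
    simp
  | succ b ih =>
    intro a
    have hd : ∀ s ∈ Set.uIcc (0 : ℝ) x, HasDerivAt (fun s : ℝ => s ^ (a + 1) * (x - s) ^ (b + 1))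
        (((a : ℝ) + 1) * (s ^ a * (x - s) ^ (b + 1))
          - ((b : ℝ) + 1) * (s ^ (a + 1) * (x - s) ^ b)) s := by
      intro s _
      have h1 := (hasDerivAt_pow (a + 1) s).mul
        (((hasDerivAt_id s).const_sub x).pow (b + 1))
      refine h1.congr_deriv ?_
      simp
      ring
    have h := intervalIntegral.integral_eq_sub_of_hasDerivAt hd
      (Continuous.intervalIntegrable (by fun_prop) _ _)
    rw [intervalIntegral.integral_sub (Continuous.intervalIntegrable (by fun_prop) _ _)
      (Continuous.intervalIntegrable (by fun_prop) _ _),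
      intervalIntegral.integral_const_mul, intervalIntegral.integral_const_mul, ih (a + 1)] at h
    simp only [sub_self, ne_eq, Nat.add_eq_zero_iff, one_ne_zero, and_false, not_false_eq_true,
      zero_pow, mul_zero, zero_mul] at h
    have e : a + 1 + b + 1 = a + (b + 1) + 1 := by ring
    rw [e] at h
    have ha : (a : ℝ) + 1 ≠ 0 := by positivity
    apply mul_left_cancel₀ ha
    rw [sub_eq_zero.1 h, Nat.factorial_succ a, Nat.factorial_succ b]
    push_cast
    ring

/-- moment integrals of the continuous binomial coefficients, where
`Nat.descFactorial a m = a(a−1)⋯(a−m+1)` is the falling factorial `(a)_m`. -/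
theorem contBinom_moment_integral (l : ℕ) (hl : 1 ≤ l) (x : ℝ) (hx : 0 ≤ x) :
    (∫ s in (0 : ℝ)..x, s ^ l * contBinom x s) =
      ∑' n : ℕ,
        (2 * (Nat.descFactorial (n + l) l : ℝ) * x ^ (2 * n + l + 1) +
            (Nat.descFactorial (n + l) (l - 1) : ℝ) * x ^ (2 * n + l + 2)) /
          (Nat.factorial (2 * n + l + 1) : ℝ) := by
  set F : ℕ → ℝ → ℝ := fun n s => (x + 2 * n + 2) * s ^ n * (x - s) ^ n /
    ((Nat.factorial n : ℝ) * (Nat.factorial (n + 1) : ℝ)) with hF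
  set B : ℕ → ℝ := fun n => (x + 2) * ((x ^ 2) ^ n / (Nat.factorial n : ℝ)) with hB
  have hBs : Summable B := (Real.summable_pow_div_factorial (x ^ 2)).mul_left _
  have hbound : ∀ n s, s ∈ Set.Icc 0 x → ‖F n s‖ ≤ B n := by
    intro n s hs
    obtain ⟨h0, h1⟩ := hs
    have h2 : 0 ≤ x - s := by linarith
    have hf : 0 < (Nat.factorial n : ℝ) := by positivity
    have hg : 0 < (Nat.factorial (n + 1) : ℝ) := by positivity
    have hn : ((n : ℝ) + 1) ≤ (Nat.factorial (n + 1) : ℝ) := by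
      exact_mod_cast Nat.self_le_factorial (n + 1)
    have hn0 : (0 : ℝ) ≤ n := by positivity
    have h3 : x + 2 * n + 2 ≤ (x + 2) * (Nat.factorial (n + 1) : ℝ) := by nlinarith
    have h4 : s ^ n * (x - s) ^ n ≤ (x ^ 2) ^ n := by
      rw [← mul_pow]
      apply pow_le_pow_left₀ (by positivity)
      nlinarith
    have h5 : 0 ≤ F n s := by simp only [hF]; positivity
    rw [Real.norm_of_nonneg h5]
    simp only [hF, hB]
    rw [div_le_iff₀ (by positivity)]
    calc (x + 2 * n + 2) * s ^ n * (x - s) ^ n = (x + 2 * n + 2) * (s ^ n * (x - s) ^ n) := by ring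
      _ ≤ ((x + 2) * (Nat.factorial (n + 1) : ℝ)) * (x ^ 2) ^ n := by gcongr
      _ = _ := by field_simp
  have key : HasSum (fun n => ∫ s in (0 : ℝ)..x, s ^ l * F n s)
      (∫ s in (0 : ℝ)..x, s ^ l * contBinom x s) := by
    refine intervalIntegral.hasSum_integral_of_dominated_convergence
      (fun n _ => x ^ l * B n) ?_ ?_ ?_ ?_ ?_
    · intro n
      exact Continuous.aestronglyMeasurable (by simp only [hF]; fun_prop)
    · intro n
      refine Filter.Eventually.of_forall fun s hs => ?_
      rw [Set.uIoc_of_le hx] at hs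
      rw [norm_mul, norm_pow, Real.norm_of_nonneg hs.1.le]
      have := hbound n s ⟨hs.1.le, hs.2⟩
      have := hs.1.le
      have := hs.2
      gcongr
    · exact Filter.Eventually.of_forall fun s _ => hBs.mul_left _
    · exact intervalIntegrable_const
    · refine Filter.Eventually.of_forall fun s hs => ?_
      rw [Set.uIoc_of_le hx] at hs
      have : Summable (fun n => F n s) :=
        Summable.of_norm_bounded hBs (fun n => hbound n s ⟨hs.1.le, hs.2⟩)
      exact this.hasSum.mul_left _
  rw [← key.tsum_eq]
  congr 1
  funext n
  have e1 : ∀ s : ℝ, s ^ l * F n s = ((x + 2 * n + 2) /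
    ((Nat.factorial n : ℝ) * (Nat.factorial (n + 1) : ℝ))) * (s ^ (n + l) * (x - s) ^ n) := by
    intro s
    simp only [hF]
    ring
  simp_rw [e1]
  rw [intervalIntegral.integral_const_mul, beta_aux]
  have d1 : (Nat.factorial n : ℝ) * (Nat.descFactorial (n + l) l : ℝ) = (Nat.factorial (n + l)) := by
    have := Nat.factorial_mul_descFactorial (n := n + l) (k := l) (by omega)
    rw [Nat.add_sub_cancel] at this
    exact_mod_cast this
  have d2 : (Nat.factorial (n + 1) : ℝ) * (Nat.descFactorial (n + l) (l - 1) : ℝ)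
      = (Nat.factorial (n + l)) := by
    have := Nat.factorial_mul_descFactorial (n := n + l) (k := l - 1) (by omega)
    rw [show n + l - (l - 1) = n + 1 by omega] at this
    exact_mod_cast this
  have hf : (Nat.factorial n : ℝ) ≠ 0 := by positivity
  have hg : (Nat.factorial (n + 1) : ℝ) ≠ 0 := by positivity
  have hh : (Nat.factorial (2 * n + l + 1) : ℝ) ≠ 0 := by positivity
  have hs : (Nat.factorial (n + 1) : ℝ) = ((n : ℝ) + 1) * (Nat.factorial n : ℝ) := by
    exact_mod_cast Nat.factorial_succ n
  rw [show n + l + n + 1 = 2 * n + l + 1 by ring, eq_div_of_mul_eq hf ((mul_comm _ _).trans d1),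
    eq_div_of_mul_eq hg ((mul_comm _ _).trans d2), hs]
  have hn1 : (n : ℝ) + 1 ≠ 0 := by positivity
  field_simp
  ring
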